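/- Assume the coercivity condition (C), the monotonicity assumption (M), assumption (E), and that ρ_i(x) = Σ_{j∈𝕀} b_{ij}(x) = 0 for every x ∈ 𝕋ⁿ and every i ∈ 𝕀. Then there exists μ⁰ = (μ⁰_i)_{i∈𝕀} ∈ P(0) such that ⟨μ⁰, L⟩ = 0 and ⟨μ, L⟩ ≥ 0 for every μ ∈ P(0); that is, 0 = ⟨μ⁰,L⟩ = min_{μ∈P(0)} ⟨μ,L⟩. -/

import Mathlib

open MeasureTheory Filter Topology RealInnerProductSpace

noncomputable section

/-- Euclidean space ℝⁿ, the universal cover of the flat torus 𝕋ⁿ = ℝⁿ/ℤⁿ. -/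
abbrev Euc (n : ℕ) := EuclideanSpace ℝ (Fin n)

/-- A vector of ℝⁿ with integer coordinates (an element of ℤⁿ). -/
def IsIntVec {n : ℕ} (z : Euc n) : Prop := ∀ i, ∃ k : ℤ, z i = (k : ℝ)

/-- ℤⁿ-periodic functions on ℝⁿ: these represent functions on the torus 𝕋ⁿ. -/
def TorusFun {n : ℕ} {α : Type*} (f : Euc n → α) : Prop :=
  ∀ (x z : Euc n), IsIntVec z → f (x + z) = f x

/-- Functions on 𝕋ⁿ × Ξ, i.e. ℤⁿ-periodic in the first variable. -/
def TorusFun2 {n : ℕ} {Ξ : Type*} {α : Type*} (f : Euc n × Ξ → α) : Prop :=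
  ∀ (x z : Euc n) (ξ : Ξ), IsIntVec z → f (x + z, ξ) = f (x, ξ)

/-- The Hamiltonian H_{φ,i}(x,p) = sup_{ξ∈Ξ} (−g_i(x,ξ)·p − φ_i(x,ξ)). -/
def ham {n m : ℕ} {Ξ : Type*} (g : Fin m → Euc n × Ξ → Euc n)
    (φ : Fin m → Euc n × Ξ → ℝ) (i : Fin m) (x p : Euc n) : ℝ :=
  ⨆ ξ : Ξ, (-⟪g i (x, ξ), p⟫ - φ i (x, ξ))

/-- The data g = (g_i), L = (L_i) consist of continuous functions on 𝕋ⁿ × Ξ. -/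
def GoodData {n m : ℕ} {Ξ : Type*} [TopologicalSpace Ξ]
    (g : Fin m → Euc n × Ξ → Euc n) (L : Fin m → Euc n × Ξ → ℝ) : Prop :=
  (∀ i, Continuous (g i) ∧ TorusFun2 (g i)) ∧ (∀ i, Continuous (L i) ∧ TorusFun2 (L i))

/-- Coercivity (C): min_{x∈𝕋ⁿ} H_i(x,p) → ∞ as |p| → ∞. -/
def Coercive {n m : ℕ} {Ξ : Type*} (g : Fin m → Euc n × Ξ → Euc n)
    (L : Fin m → Euc n × Ξ → ℝ) : Prop :=
  ∀ (i : Fin m) (M : ℝ), ∃ R : ℝ, ∀ p : Euc n, R ≤ ‖p‖ → ∀ x : Euc n, M ≤ ham g L i x p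

/-- A monotone m×m real matrix. -/
def IsMonotoneMat {m : ℕ} (B : Matrix (Fin m) (Fin m) ℝ) : Prop :=
  ∀ (u : Fin m → ℝ) (k : Fin m), (∀ i, u i ≤ u k) → 0 ≤ u k → 0 ≤ ∑ j, B k j * u j

/-- Assumption (M): B(x) has continuous entries (as functions on 𝕋ⁿ) and is monotone
for every x. -/
def GoodCoupling {n m : ℕ} (B : Euc n → Matrix (Fin m) (Fin m) ℝ) : Prop :=
  (∀ i j, Continuous (fun x => B x i j) ∧ TorusFun (fun x => B x i j)) ∧
    ∀ x, IsMonotoneMat (B x)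

/-- Viscosity subsolution of λu + Bu + H_φ[u] = c in 𝕋ⁿ. -/
def IsSubsol {n m : ℕ} {Ξ : Type*} (B : Euc n → Matrix (Fin m) (Fin m) ℝ) (lam : ℝ)
    (g : Fin m → Euc n × Ξ → Euc n) (φ : Fin m → Euc n × Ξ → ℝ)
    (c : Fin m → ℝ) (u : Fin m → Euc n → ℝ) : Prop :=
  (∀ i, UpperSemicontinuous (u i) ∧ TorusFun (u i)) ∧
    ∀ (i : Fin m) (ψ : Euc n → ℝ), ContDiff ℝ 1 ψ → TorusFun ψ →
      ∀ x : Euc n, IsLocalMax (fun y => u i y - ψ y) x →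
        lam * u i x + (∑ j, B x i j * u j x) + ham g φ i x (gradient ψ x) ≤ c i

/-- Viscosity supersolution of λu + Bu + H_φ[u] = c in 𝕋ⁿ. -/
def IsSupersol {n m : ℕ} {Ξ : Type*} (B : Euc n → Matrix (Fin m) (Fin m) ℝ) (lam : ℝ)
    (g : Fin m → Euc n × Ξ → Euc n) (φ : Fin m → Euc n × Ξ → ℝ)
    (c : Fin m → ℝ) (u : Fin m → Euc n → ℝ) : Prop :=
  (∀ i, LowerSemicontinuous (u i) ∧ TorusFun (u i)) ∧
    ∀ (i : Fin m) (ψ : Euc n → ℝ), ContDiff ℝ 1 ψ → TorusFun ψ →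
      ∀ x : Euc n, IsLocalMin (fun y => u i y - ψ y) x →
        c i ≤ lam * u i x + (∑ j, B x i j * u j x) + ham g φ i x (gradient ψ x)

/-- Viscosity solution of λu + Bu + H_φ[u] = c in 𝕋ⁿ. -/
def IsSol {n m : ℕ} {Ξ : Type*} (B : Euc n → Matrix (Fin m) (Fin m) ℝ) (lam : ℝ)
    (g : Fin m → Euc n × Ξ → Euc n) (φ : Fin m → Euc n × Ξ → ℝ)
    (c : Fin m → ℝ) (u : Fin m → Euc n → ℝ) : Prop :=
  (∀ i, Continuous (u i)) ∧ IsSubsol B lam g φ c u ∧ IsSupersol B lam g φ c u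

/-- (φ,u) ∈ F(λ): φ ∈ C(𝕋ⁿ×Ξ)ᵐ, u ∈ C(𝕋ⁿ)ᵐ and u is a viscosity subsolution of
B^λ u + H_φ[u] = 0 in 𝕋ⁿ. -/
def memF {n m : ℕ} {Ξ : Type*} [TopologicalSpace Ξ]
    (B : Euc n → Matrix (Fin m) (Fin m) ℝ) (lam : ℝ)
    (g : Fin m → Euc n × Ξ → Euc n)
    (φ : Fin m → Euc n × Ξ → ℝ) (u : Fin m → Euc n → ℝ) : Prop :=
  (∀ i, Continuous (φ i) ∧ TorusFun2 (φ i)) ∧ (∀ i, Continuous (u i)) ∧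
    IsSubsol B lam g φ (fun _ => 0) u

/-- ρ_i(x) = Σ_j b_{ij}(x). -/
def rhoB {n m : ℕ} (B : Euc n → Matrix (Fin m) (Fin m) ℝ) (i : Fin m) (x : Euc n) : ℝ :=
  ∑ j, B x i j

/-- ν ∈ P_{B^λ}: a family of finite nonnegative Borel measures with ⟨ν, B^λ1⟩ = 1. -/
def memPB {n m : ℕ} {Ξ : Type*} [MeasurableSpace Ξ]
    (B : Euc n → Matrix (Fin m) (Fin m) ℝ) (lam : ℝ)
    (ν : Fin m → Measure (Euc n × Ξ)) : Prop :=
  (∀ i, IsFiniteMeasure (ν i)) ∧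
    (∑ i, ∫ q, (lam + rhoB B i q.1) ∂(ν i)) = 1

/-- ν ∈ G'(z,k,λ): ν ∈ P_{B^λ} and ⟨ν, φ − u_k(z) B^λ1⟩ ≥ 0 for every (φ,u) ∈ F(λ). -/
def memGP {n m : ℕ} {Ξ : Type*} [TopologicalSpace Ξ] [MeasurableSpace Ξ]
    (B : Euc n → Matrix (Fin m) (Fin m) ℝ) (lam : ℝ)
    (g : Fin m → Euc n × Ξ → Euc n) (z : Euc n) (k : Fin m)
    (ν : Fin m → Measure (Euc n × Ξ)) : Prop :=
  memPB B lam ν ∧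
    ∀ φ u, memF B lam g φ u →
      0 ≤ ∑ i, ∫ q, (φ i q - u k z * (lam + rhoB B i q.1)) ∂(ν i)

/-- μ ∈ P: a family of nonnegative Borel measures of total mass 1. -/
def memP {n m : ℕ} {Ξ : Type*} [MeasurableSpace Ξ]
    (μ : Fin m → Measure (Euc n × Ξ)) : Prop :=
  (∀ i, IsFiniteMeasure (μ i)) ∧ (∑ i, (μ i Set.univ).toReal) = 1

/-- μ ∈ P(z,k,λ): μ ∈ P and Σ_i ⟨μ_i, (λ+ρ_i)⁻¹ φ_i⟩ ≥ u_k(z) for all (φ,u) ∈ F(λ). -/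
def memPzk {n m : ℕ} {Ξ : Type*} [TopologicalSpace Ξ] [MeasurableSpace Ξ]
    (B : Euc n → Matrix (Fin m) (Fin m) ℝ) (lam : ℝ)
    (g : Fin m → Euc n × Ξ → Euc n) (z : Euc n) (k : Fin m)
    (μ : Fin m → Measure (Euc n × Ξ)) : Prop :=
  memP μ ∧
    ∀ φ u, memF B lam g φ u →
      u k z ≤ ∑ i, ∫ q, (lam + rhoB B i q.1)⁻¹ * φ i q ∂(μ i)

/-- μ ∈ P(0): μ ∈ P and ⟨μ,φ⟩ ≥ 0 for all (φ,u) ∈ F(0). -/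
def memP0 {n m : ℕ} {Ξ : Type*} [TopologicalSpace Ξ] [MeasurableSpace Ξ]
    (B : Euc n → Matrix (Fin m) (Fin m) ℝ)
    (g : Fin m → Euc n × Ξ → Euc n)
    (μ : Fin m → Measure (Euc n × Ξ)) : Prop :=
  memP μ ∧ ∀ φ u, memF B 0 g φ u → 0 ≤ ∑ i, ∫ q, φ i q ∂(μ i)

/-- μ ∈ M₊(0): a family of finite nonnegative Borel measures with ⟨μ,φ⟩ ≥ 0 for all
(φ,u) ∈ F(0). -/
def memM0 {n m : ℕ} {Ξ : Type*} [TopologicalSpace Ξ] [MeasurableSpace Ξ]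
    (B : Euc n → Matrix (Fin m) (Fin m) ℝ)
    (g : Fin m → Euc n × Ξ → Euc n)
    (μ : Fin m → Measure (Euc n × Ξ)) : Prop :=
  (∀ i, IsFiniteMeasure (μ i)) ∧ ∀ φ u, memF B 0 g φ u → 0 ≤ ∑ i, ∫ q, φ i q ∂(μ i)

/-- Assumption (E): problem (P₀) has a Lipschitz continuous viscosity solution. -/
def AssumptionE {n m : ℕ} {Ξ : Type*} (B : Euc n → Matrix (Fin m) (Fin m) ℝ)
    (g : Fin m → Euc n × Ξ → Euc n) (L : Fin m → Euc n × Ξ → ℝ) : Prop :=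
  ∃ v₀ : Fin m → Euc n → ℝ, (∀ i, ∃ K : NNReal, LipschitzWith K (v₀ i)) ∧
    IsSol B 0 g L (fun _ => 0) v₀

end


def cube (n : ℕ) : Set (Euc n) := {x | ∀ i, x i ∈ Set.Icc (0:ℝ) 1}

lemma isCompact_cube (n : ℕ) : IsCompact (cube n) := by
  have h := isCompact_univ_pi (X := fun _ : Fin n => ℝ) (s := fun _ => Set.Icc (0:ℝ) 1)
    (fun _ => isCompact_Icc)
  have h2 := h.image (PiLp.continuous_toLp 2 (fun _ : Fin n => ℝ))
  convert h2 using 1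
  ext x
  constructor
  · intro hx
    exact ⟨x.ofLp, fun i _ => hx i, rfl⟩
  · rintro ⟨y, hy, rfl⟩ i
    exact hy i (Set.mem_univ i)

lemma IsIntVec.zero {n : ℕ} : IsIntVec (0 : Euc n) := fun i => ⟨0, by simp⟩

lemma IsIntVec.neg {n : ℕ} {z : Euc n} (h : IsIntVec z) : IsIntVec (-z) := by
  intro i
  obtain ⟨k, hk⟩ := h i
  exact ⟨-k, by simp [hk]⟩

lemma exists_cube {n : ℕ} (x : Euc n) : ∃ z, IsIntVec z ∧ x + z ∈ cube n := by
  refine ⟨WithLp.toLp 2 (fun i => -(⌊x i⌋ : ℝ)), fun i => ⟨-⌊x i⌋, by simp⟩, fun i => ?_⟩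
  have h1 := Int.floor_le (x i)
  have h2 := Int.lt_floor_add_one (x i)
  constructor
  · simpa using h1
  · simp
    linarith

/-- periodic penalty -/
noncomputable def Pen {n : ℕ} (z : Euc n) : ℝ := ∑ i, (1 - Real.cos (2 * Real.pi * z i))

lemma Pen_contDiff {n : ℕ} : ContDiff ℝ 1 (Pen (n := n)) := by
  unfold Pen
  fun_prop

lemma Pen_cont {n : ℕ} : Continuous (Pen (n := n)) := Pen_contDiff.continuous

lemma Pen_per {n : ℕ} : TorusFun (Pen (n := n)) := by
  intro x z hz
  unfold Pen
  refine Finset.sum_congr rfl fun i _ => ?_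
  obtain ⟨k, hk⟩ := hz i
  have : 2 * Real.pi * (x + z) i = 2 * Real.pi * x i + k * (2 * Real.pi) := by
    simp [hk]; ring
  rw [this, Real.cos_add_int_mul_two_pi]

lemma Pen_nonneg {n : ℕ} (z : Euc n) : 0 ≤ Pen z :=
  Finset.sum_nonneg fun i _ => by linarith [Real.cos_le_one (2 * Real.pi * z i)]

lemma Pen_zero {n : ℕ} : Pen (0 : Euc n) = 0 := by simp [Pen]

lemma Pen_int {n : ℕ} {z : Euc n} (h : Pen z ≤ 0) : IsIntVec z := by
  intro i
  have h0 : Pen z = 0 := le_antisymm h (Pen_nonneg z)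
  have := (Finset.sum_eq_zero_iff_of_nonneg (fun i _ => by
    linarith [Real.cos_le_one (2 * Real.pi * z i)])).1 h0 i (Finset.mem_univ i)
  have h1 : Real.cos (2 * Real.pi * z i) = 1 := by linarith
  obtain ⟨k, hk⟩ := (Real.cos_eq_one_iff _).1 h1
  refine ⟨k, ?_⟩
  have : (2 * Real.pi) * (z i - k) = 0 := by linarith
  have h2 : (2 * Real.pi) ≠ 0 := by positivity
  have := (mul_eq_zero.1 this).resolve_left h2
  linarith

lemma TorusFun.sub_int {n : ℕ} {α : Type*} {f : Euc n → α} (h : TorusFun f) (x : Euc n)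
    {z : Euc n} (hz : IsIntVec z) : f (x - z) = f x := by
  rw [sub_eq_add_neg]; exact h x _ hz.neg

lemma doubling {n : ℕ} {ι : Type*} [Finite ι] [Nonempty ι] [TopologicalSpace ι]
    [DiscreteTopology ι] (F : ι → Euc n × Euc n → ℝ) (hc : ∀ i, Continuous (F i))
    (hp : ∀ i x y z w, IsIntVec z → IsIntVec w → F i (x + z, y + w) = F i (x, y)) :
    ∃ (i : ι) (xh : Euc n) (x y : ℕ → Euc n) (κ : ℕ → ℝ),
      Tendsto x atTop (𝓝 xh) ∧ Tendsto y atTop (𝓝 xh) ∧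
      (∀ k j a b, F j (a, b) - κ k * Pen (a - b) ≤ F i (x k, y k) - κ k * Pen (x k - y k)) ∧
      ∀ j a, F j (a, a) ≤ F i (xh, xh) := by
  have hFc : Continuous (fun q : ι × Euc n × Euc n => F q.1 q.2) := by
    rw [continuous_iff_continuousAt]
    rintro ⟨i, q⟩
    have : (fun q : ι × Euc n × Euc n => F q.1 q.2) =ᶠ[𝓝 (i, q)] fun q => F i q.2 := by
      have h1 : ∀ᶠ q : ι × Euc n × Euc n in 𝓝 (i, q), q.1 = i := by
        have := (continuous_fst (X := ι) (Y := Euc n × Euc n)).continuousAt (x := (i, q))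
        exact this (show {a : ι | a = i} ∈ 𝓝 i by simp)
      filter_upwards [h1] with q hq
      rw [hq]
    exact (((hc i).comp continuous_snd).continuousAt).congr this.symm
  have hGc : ∀ k : ℕ, Continuous (fun q : ι × Euc n × Euc n =>
      F q.1 q.2 - (k : ℝ) * Pen (q.2.1 - q.2.2)) := fun k =>
    hFc.sub (continuous_const.mul (Pen_cont.comp (by fun_prop)))
  have hQ : IsCompact ((Set.univ : Set ι) ×ˢ (cube n ×ˢ cube n)) :=
    (Set.finite_univ.isCompact).prod ((isCompact_cube n).prod (isCompact_cube n))
  obtain ⟨z0, hz0, hz0c⟩ := exists_cube (0 : Euc n)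
  have i0 : ι := Classical.arbitrary ι
  have hne : ((Set.univ : Set ι) ×ˢ (cube n ×ˢ cube n)).Nonempty :=
    ⟨(i0, 0 + z0, 0 + z0), Set.mem_univ _, hz0c, hz0c⟩
  have hmax : ∀ k : ℕ, ∃ q ∈ ((Set.univ : Set ι) ×ˢ (cube n ×ˢ cube n)),
      ∀ j a b, F j (a, b) - (k : ℝ) * Pen (a - b) ≤
        F q.1 q.2 - (k : ℝ) * Pen (q.2.1 - q.2.2) := by
    intro k
    obtain ⟨q, hq, hqm⟩ := hQ.exists_isMaxOn hne (hGc k).continuousOn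
    refine ⟨q, hq, fun j a b => ?_⟩
    obtain ⟨z, hz, hza⟩ := exists_cube a
    obtain ⟨w, hw, hwb⟩ := exists_cube b
    have h1 : F j (a + z, b + w) - (k : ℝ) * Pen (a + z - (b + w)) ≤ _ :=
      hqm (show (j, a + z, b + w) ∈ _ from ⟨Set.mem_univ _, hza, hwb⟩)
    rw [hp j a b z w hz hw] at h1
    have h2 : a + z - (b + w) = (a - b) + z - w := by abel
    rw [h2, Pen_per.sub_int _ hw, Pen_per _ _ hz] at h1
    exact h1
  choose q hqQ hqm using hmax
  obtain ⟨⟨i, xh, yh⟩, -, φ, hφ, hlim⟩ := hQ.tendsto_subseq hqQ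
  have hl1 : Tendsto (fun k => (q (φ k)).1) atTop (𝓝 i) :=
    (continuous_fst.tendsto _).comp hlim
  have hlx : Tendsto (fun k => (q (φ k)).2.1) atTop (𝓝 xh) :=
    ((continuous_fst.comp continuous_snd).tendsto _).comp hlim
  have hly : Tendsto (fun k => (q (φ k)).2.2) atTop (𝓝 yh) :=
    ((continuous_snd.comp continuous_snd).tendsto _).comp hlim
  have hPl : Tendsto (fun k => Pen ((q (φ k)).2.1 - (q (φ k)).2.2)) atTop (𝓝 (Pen (xh - yh))) :=
    (Pen_cont.tendsto _).comp (hlx.sub hly)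
  have hP0 : Pen (xh - yh) ≤ 0 := by
    set C := F (q 0).1 (q 0).2 - F i0 (0, 0) with hC
    have hb : ∀ k : ℕ, (k : ℝ) * Pen ((q k).2.1 - (q k).2.2) ≤ C := by
      intro k
      have h1 := hqm k i0 0 0
      have h2 := hqm 0 (q k).1 (q k).2.1 (q k).2.2
      simp [Pen_zero] at h1 h2
      simp only [hC]
      linarith
    have hCl : Tendsto (fun k : ℕ => C / ((φ k : ℕ) : ℝ)) atTop (𝓝 0) :=
      (tendsto_const_div_atTop_nhds_zero_nat C).comp hφ.tendsto_atTop
    refine le_of_tendsto_of_tendsto hPl hCl ?_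
    filter_upwards [eventually_ge_atTop 1] with k hk
    have : (0:ℝ) < (φ k : ℝ) := by
      have := hφ.le_apply (x := k)
      exact_mod_cast (by omega : 0 < φ k)
    rw [le_div_iff₀ this, mul_comm]
    exact hb _
  have hz := Pen_int hP0
  have hev : ∀ᶠ k in atTop, (q (φ k)).1 = i := hl1 (show {a : ι | a = i} ∈ 𝓝 i by simp)
  obtain ⟨N, hN⟩ := eventually_atTop.1 hev
  have hmx : ∀ k j a b, F j (a, b) - (φ (k + N) : ℝ) * Pen (a - b) ≤
      F i ((q (φ (k + N))).2.1, (q (φ (k + N))).2.2 + (xh - yh)) -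
        (φ (k + N) : ℝ) * Pen ((q (φ (k + N))).2.1 - ((q (φ (k + N))).2.2 + (xh - yh))) := by
    intro k j a b
    have h1 := hqm (φ (k + N)) j a b
    rw [hN _ (by omega)] at h1
    have h2 := hp i (q (φ (k + N))).2.1 (q (φ (k + N))).2.2 0 _ IsIntVec.zero hz
    rw [add_zero] at h2
    rw [h2, ← sub_sub, Pen_per.sub_int _ hz]
    exact h1
  have tx : Tendsto (fun k => (q (φ (k + N))).2.1) atTop (𝓝 xh) :=
    hlx.comp (tendsto_add_atTop_nat N)
  have ty : Tendsto (fun k => (q (φ (k + N))).2.2 + (xh - yh)) atTop (𝓝 xh) := by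
    have := (hly.comp (tendsto_add_atTop_nat N)).add_const (xh - yh)
    simpa using this
  refine ⟨i, xh, _, _, fun k => (φ (k + N) : ℝ), tx, ty, hmx, fun j a => ?_⟩
  refine ge_of_tendsto (((hc i).tendsto _).comp (tx.prodMk_nhds ty)) (Eventually.of_forall fun k => ?_)
  have h1 := hmx k j a a
  rw [sub_self, Pen_zero] at h1
  have h2 := mul_nonneg (Nat.cast_nonneg (α := ℝ) (φ (k + N)))
    (Pen_nonneg ((q (φ (k + N))).2.1 - ((q (φ (k + N))).2.2 + (xh - yh))))
  simp only [Function.comp]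
  linarith

/-- penalising a local maximum into a global one -/
lemma localMax_pen {n : ℕ} (w : Euc n → ℝ) (hw : Continuous w) (hp : TorusFun w) (x0 : Euc n)
    (hx : IsLocalMax w x0) : ∃ A : ℝ, ∀ x, w x - A * Pen (x - x0) ≤ w x0 := by
  by_contra hcon
  push Not at hcon
  have h1 : ∀ k : ℕ, ∃ x ∈ cube n, w x0 < w x - k * Pen (x - x0) := by
    intro k
    obtain ⟨x, hx⟩ := hcon k
    obtain ⟨z, hz, hzx⟩ := exists_cube x
    refine ⟨x + z, hzx, ?_⟩
    rw [hp _ _ hz, show x + z - x0 = (x - x0) + z by abel, Pen_per _ _ hz]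
    exact hx
  choose x hxQ hxm using h1
  obtain ⟨xh, -, φ, hφ, hlim⟩ := (isCompact_cube n).tendsto_subseq hxQ
  obtain ⟨C, hC⟩ := ((isCompact_cube n).image hw).bddAbove
  have hP0 : Pen (xh - x0) ≤ 0 := by
    have hPl : Tendsto (fun k => Pen (x (φ k) - x0)) atTop (𝓝 (Pen (xh - x0))) :=
      (Pen_cont.tendsto _).comp (hlim.sub_const x0)
    have hCl : Tendsto (fun k : ℕ => (C - w x0) / ((φ k : ℕ) : ℝ)) atTop (𝓝 0) :=
      (tendsto_const_div_atTop_nhds_zero_nat _).comp hφ.tendsto_atTop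
    refine le_of_tendsto_of_tendsto hPl hCl ?_
    filter_upwards [eventually_ge_atTop 1] with k hk
    have : (0:ℝ) < (φ k : ℝ) := by
      have := hφ.le_apply (x := k)
      exact_mod_cast (by omega : 0 < φ k)
    rw [le_div_iff₀ this, mul_comm]
    have h1 := hxm (φ k)
    have h2 := hC (Set.mem_image_of_mem w (hxQ (φ k)))
    linarith
  have hz := Pen_int hP0
  have ht : Tendsto (fun k => x (φ k) - (xh - x0)) atTop (𝓝 x0) := by
    have := hlim.sub_const (xh - x0)
    simpa using this
  have hev := ht.eventually hx
  obtain ⟨k, hk⟩ := hev.exists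
  rw [hp.sub_int _ hz] at hk
  have h1 := hxm (φ k)
  have h2 := mul_nonneg (Nat.cast_nonneg (α := ℝ) (φ k)) (Pen_nonneg (x (φ k) - x0))
  linarith

lemma hasGrad_left {n : ℕ} (κ : ℝ) (x y : Euc n) :
    HasGradientAt (fun a => κ * Pen (a - y)) (κ • gradient Pen (x - y)) x := by
  have h0 : DifferentiableAt ℝ (Pen (n := n)) (x - y) :=
    (Pen_contDiff.differentiable (by norm_num)).differentiableAt
  have h1 := h0.hasGradientAt.hasFDerivAt
  have h2 := (h1.comp x ((hasFDerivAt_id x).sub_const y)).const_mul κ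
  rw [hasGradientAt_iff_hasFDerivAt]
  refine h2.congr_fderiv ?_
  ext v
  simp

lemma hasGrad_right {n : ℕ} (κ : ℝ) (x y : Euc n) :
    HasGradientAt (fun b => κ * Pen (x - b)) (-(κ • gradient Pen (x - y))) y := by
  have h0 : DifferentiableAt ℝ (Pen (n := n)) (x - y) :=
    (Pen_contDiff.differentiable (by norm_num)).differentiableAt
  have h1 := h0.hasGradientAt.hasFDerivAt
  have h2 := (h1.comp y ((hasFDerivAt_id y).const_sub x)).const_mul κ
  rw [hasGradientAt_iff_hasFDerivAt]
  refine h2.congr_fderiv ?_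
  ext v
  simp

lemma hasGrad_add {n : ℕ} {f h : Euc n → ℝ} {a b x : Euc n} (hf : HasGradientAt f a x)
    (hh : HasGradientAt h b x) : HasGradientAt (fun y => f y + h y) (a + b) x := by
  rw [hasGradientAt_iff_hasFDerivAt] at *
  rw [map_add]
  exact hf.add hh

lemma hasGrad_smul {n : ℕ} {f : Euc n → ℝ} {a x : Euc n} (c : ℝ) (hf : HasGradientAt f a x) :
    HasGradientAt (fun y => c * f y) (c • a) x := by
  rw [hasGradientAt_iff_hasFDerivAt] at *
  refine (hf.const_mul c).congr_fderiv ?_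
  ext v
  simp

lemma gradient_cont {n : ℕ} {f : Euc n → ℝ} (hf : ContDiff ℝ 1 f) : Continuous (gradient f) := by
  have h := hf.continuous_fderiv (by norm_num)
  unfold gradient
  exact (InnerProductSpace.toDual ℝ (Euc n)).symm.continuous.comp h

lemma gradient_Pen_zero {n : ℕ} : gradient Pen (0 : Euc n) = 0 := by
  have h : IsLocalMin (Pen (n := n)) 0 := Eventually.of_forall fun x => by
    rw [Pen_zero]; exact Pen_nonneg x
  unfold gradient
  rw [h.fderiv_eq_zero, map_zero]

set_option linter.unusedSectionVars false

section
variable {n m : ℕ} {Ξ : Type*} [MetricSpace Ξ] [CompactSpace Ξ] [Nonempty Ξ]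

lemma ham_bdd {g : Fin m → Euc n × Ξ → Euc n} {φ : Fin m → Euc n × Ξ → ℝ} {i : Fin m}
    (hg : Continuous (g i)) (hφ : Continuous (φ i)) (x p : Euc n) :
    BddAbove (Set.range fun ξ : Ξ => -⟪g i (x, ξ), p⟫ - φ i (x, ξ)) :=
  (isCompact_range (by fun_prop)).bddAbove

lemma le_ham {g : Fin m → Euc n × Ξ → Euc n} {φ : Fin m → Euc n × Ξ → ℝ} {i : Fin m}
    (hg : Continuous (g i)) (hφ : Continuous (φ i)) (x p : Euc n) (ξ : Ξ) :
    -⟪g i (x, ξ), p⟫ - φ i (x, ξ) ≤ ham g φ i x p :=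
  le_ciSup (ham_bdd hg hφ x p) ξ

lemma ham_attained {g : Fin m → Euc n × Ξ → Euc n} {φ : Fin m → Euc n × Ξ → ℝ} {i : Fin m}
    (hg : Continuous (g i)) (hφ : Continuous (φ i)) (x p : Euc n) :
    ∃ ξ : Ξ, ham g φ i x p = -⟪g i (x, ξ), p⟫ - φ i (x, ξ) := by
  obtain ⟨ξ, -, hξ⟩ := isCompact_univ.exists_isMaxOn (Set.univ_nonempty (α := Ξ))
    (f := fun ξ : Ξ => -⟪g i (x, ξ), p⟫ - φ i (x, ξ)) (by fun_prop)
  exact ⟨ξ, le_antisymm (ciSup_le fun η => hξ (Set.mem_univ η)) (le_ham hg hφ x p ξ)⟩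

lemma torus_bdd {f : Euc n × Ξ → ℝ} (hf : Continuous f) (hp : TorusFun2 f) :
    ∃ C, ∀ q, |f q| ≤ C := by
  obtain ⟨C, hC⟩ := (((isCompact_cube n).prod (isCompact_univ (X := Ξ))).image
    (continuous_abs.comp hf)).bddAbove
  refine ⟨C, fun ⟨x, ξ⟩ => ?_⟩
  obtain ⟨z, hz, hzx⟩ := exists_cube x
  rw [← hp x z ξ hz]
  exact hC ⟨(x + z, ξ), ⟨hzx, Set.mem_univ _⟩, rfl⟩

lemma coercive_bound {g : Fin m → Euc n × Ξ → Euc n} {L φ : Fin m → Euc n × Ξ → ℝ}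
    (hgL : GoodData g L) (hcoer : Coercive g L) (i : Fin m)
    (hφ : Continuous (φ i) ∧ TorusFun2 (φ i)) (M : ℝ) :
    ∃ R, ∀ x p, ham g φ i x p ≤ M → ‖p‖ ≤ R := by
  obtain ⟨C1, hC1⟩ := torus_bdd hφ.1 hφ.2
  obtain ⟨C2, hC2⟩ := torus_bdd (hgL.2 i).1 (hgL.2 i).2
  obtain ⟨R, hR⟩ := hcoer i (M + C1 + C2 + 1)
  refine ⟨R, fun x p h => ?_⟩
  by_contra hcon
  have h1 := hR p (le_of_not_ge hcon) x
  obtain ⟨ξ, hξ⟩ := ham_attained (hgL.1 i).1 (hgL.2 i).1 x p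
  have h2 := le_ham (hgL.1 i).1 hφ.1 x p ξ
  have h3 := abs_le.1 (hC1 (x, ξ))
  have h4 := abs_le.1 (hC2 (x, ξ))
  linarith

lemma bounded_along {f : Euc n → ℝ} (hf : Continuous f) {x : ℕ → Euc n} {xh : Euc n}
    (hx : Tendsto x atTop (𝓝 xh)) : ∃ M, ∀ k, -f (x k) ≤ M := by
  obtain ⟨M, hM⟩ := ((hf.neg.tendsto _).comp hx).bddAbove_range
  exact ⟨M, fun k => hM ⟨k, rfl⟩⟩

lemma memF_add {g : Fin m → Euc n × Ξ → Euc n} {L : Fin m → Euc n × Ξ → ℝ}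
    (hgL : GoodData g L) (hcoer : Coercive g L)
    {B : Euc n → Matrix (Fin m) (Fin m) ℝ} (hB : GoodCoupling B)
    {φ₁ φ₂ : Fin m → Euc n × Ξ → ℝ} {u₁ u₂ : Fin m → Euc n → ℝ}
    (h₁ : memF B 0 g φ₁ u₁) (h₂ : memF B 0 g φ₂ u₂) :
    memF B 0 g (fun i q => φ₁ i q + φ₂ i q) (fun i x => u₁ i x + u₂ i x) := by
  obtain ⟨hφ₁, hu₁, hs₁, ht₁⟩ := h₁
  obtain ⟨hφ₂, hu₂, hs₂, ht₂⟩ := h₂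
  refine ⟨fun i => ⟨(hφ₁ i).1.add (hφ₂ i).1, fun x z ξ hz => ?_⟩,
    fun i => (hu₁ i).add (hu₂ i),
    fun i => ⟨((hu₁ i).add (hu₂ i)).upperSemicontinuous, fun x z hz => ?_⟩, ?_⟩
  · simp only [(hφ₁ i).2 x z ξ hz, (hφ₂ i).2 x z ξ hz]
  · simp only [(hs₁ i).2 x z hz, (hs₂ i).2 x z hz]
  intro i ψ hψ hψp x0 hmax
  obtain ⟨A, hA⟩ := localMax_pen (fun y => u₁ i y + u₂ i y - ψ y)
    (((hu₁ i).add (hu₂ i)).sub hψ.continuous)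
    (fun x z hz => by simp only [(hs₁ i).2 x z hz, (hs₂ i).2 x z hz, hψp x z hz]) x0 hmax
  set F : Unit → Euc n × Euc n → ℝ := fun _ q =>
    u₁ i q.1 + u₂ i q.2 - ψ q.1 - (A + 1) * Pen (q.1 - x0) with hF
  have hu1c := hu₁ i
  have hu2c := hu₂ i
  have hψc := hψ.continuous
  have hFc : ∀ j, Continuous (F j) := fun j => by
    have := Pen_cont (n := n)
    simp only [hF]
    fun_prop
  have hFp : ∀ j x y z w, IsIntVec z → IsIntVec w → F j (x + z, y + w) = F j (x, y) := by
    intro j x y z w hz hw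
    simp only [hF]
    rw [(hs₁ i).2 x z hz, (hs₂ i).2 y w hw, hψp x z hz,
      show x + z - x0 = (x - x0) + z by abel, Pen_per _ _ hz]
  obtain ⟨_, xh, x', y', κ, hx', hy', hmx', hd⟩ := doubling F hFc hFp
  have hz : IsIntVec (xh - x0) := by
    apply Pen_int
    have h1 := hd () x0
    have h2 := hA xh
    simp only [hF, sub_self, Pen_zero] at h1
    linarith
  obtain ⟨x, y, hx, hy, hmx⟩ : ∃ x y : ℕ → Euc n, Tendsto x atTop (𝓝 x0) ∧
      Tendsto y atTop (𝓝 x0) ∧ (∀ k a b, F () (a, b) - κ k * Pen (a - b) ≤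
        F () (x k, y k) - κ k * Pen (x k - y k)) := by
    refine ⟨fun k => x' k + -(xh - x0), fun k => y' k + -(xh - x0), ?_, ?_, fun k a b => ?_⟩
    · simpa using hx'.add_const (-(xh - x0))
    · simpa using hy'.add_const (-(xh - x0))
    · rw [hFp () _ _ _ _ hz.neg hz.neg, add_sub_add_right_eq_sub]
      exact hmx' k () a b
  set p : ℕ → Euc n := fun k => κ k • gradient Pen (x k - y k) with hp
  set q : ℕ → Euc n := fun k => gradient ψ (x k) + (A + 1) • gradient Pen (x k - x0) with hq
  have hql : Tendsto q atTop (𝓝 (gradient ψ x0)) := by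
    have e1 := ((gradient_cont hψ).tendsto _).comp hx
    have e2 := (((gradient_cont (Pen_contDiff (n := n))).tendsto _).comp
      (hx.sub_const x0)).const_smul (A + 1)
    have := e1.add e2
    rw [sub_self, gradient_Pen_zero, smul_zero, add_zero] at this
    exact this
  -- first inequality
  have hS1 : ∀ k, (∑ j, B (x k) i j * u₁ j (x k)) + ham g φ₁ i (x k) (q k + p k) ≤ 0 := by
    intro k
    have hcd : ContDiff ℝ 1 (fun a => ψ a + (A + 1) * Pen (a - x0) + κ k * Pen (a - y k)) := by
      have := Pen_contDiff (n := n)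
      fun_prop
    have htp : TorusFun (fun a => ψ a + (A + 1) * Pen (a - x0) + κ k * Pen (a - y k)) := by
      intro a z hz
      simp only [hψp a z hz, show a + z - x0 = (a - x0) + z by abel,
        show a + z - y k = (a - y k) + z by abel, Pen_per _ _ hz]
    have hgr : gradient (fun a => ψ a + (A + 1) * Pen (a - x0) + κ k * Pen (a - y k)) (x k)
        = q k + p k :=
      (hasGrad_add (hasGrad_add
        ((hψ.differentiable (by norm_num)).differentiableAt.hasGradientAt)
        (hasGrad_left (A + 1) (x k) x0)) (hasGrad_left (κ k) (x k) (y k))).gradient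
    have := ht₁ i _ hcd htp (x k) (Eventually.of_forall fun a => by
      have := hmx k a (y k)
      simp only [hF] at this
      linarith)
    rw [hgr] at this
    linarith
  have hS2 : ∀ k, (∑ j, B (y k) i j * u₂ j (y k)) + ham g φ₂ i (y k) (-p k) ≤ 0 := by
    intro k
    have hcd : ContDiff ℝ 1 (fun b => κ k * Pen (x k - b)) := by
      have := Pen_contDiff (n := n)
      fun_prop
    have htp : TorusFun (fun b => κ k * Pen (x k - b)) := by
      intro a z hz
      simp only [show x k - (a + z) = (x k - a) - z by abel, Pen_per.sub_int _ hz]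
    have hgr := (hasGrad_right (κ k) (x k) (y k)).gradient
    have := ht₂ i _ hcd htp (y k) (Eventually.of_forall fun b => by
      have := hmx k (x k) b
      simp only [hF] at this
      linarith)
    rw [hgr] at this
    linarith
  have hc1 : Continuous fun x => ∑ j, B x i j * u₁ j x :=
    continuous_finsetSum _ fun j _ => (hB.1 i j).1.mul (hu₁ j)
  have hc2 : Continuous fun x => ∑ j, B x i j * u₂ j x :=
    continuous_finsetSum _ fun j _ => (hB.1 i j).1.mul (hu₂ j)
  obtain ⟨M, hM⟩ := bounded_along hc1 hx
  obtain ⟨R, hR⟩ := coercive_bound hgL hcoer i (hφ₁ i) M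
  have hb : ∀ k, q k + p k ∈ Metric.closedBall (0 : Euc n) R := by
    intro k
    rw [mem_closedBall_zero_iff]
    refine hR (x k) _ ?_
    have := hM k
    have := hS1 k
    linarith
  obtain ⟨r, -, θ, hθ, hr⟩ := (isCompact_closedBall (0 : Euc n) R).tendsto_subseq hb
  have hxθ := hx.comp hθ.tendsto_atTop
  have hyθ := hy.comp hθ.tendsto_atTop
  have hqθ := hql.comp hθ.tendsto_atTop
  have hpθ : Tendsto (fun k => -p (θ k)) atTop (𝓝 (gradient ψ x0 - r)) := by
    have := hqθ.sub hr
    refine this.congr fun k => ?_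
    simp only [Function.comp]
    abel
  have hgc := (hgL.1 i).1
  have key : ∀ ξ, (∑ j, B x0 i j * u₁ j x0) + (∑ j, B x0 i j * u₂ j x0)
      + (-⟪g i (x0, ξ), gradient ψ x0⟫ - (φ₁ i (x0, ξ) + φ₂ i (x0, ξ))) ≤ 0 := by
    intro ξ
    have tg1 : Tendsto (fun k => g i (x (θ k), ξ)) atTop (𝓝 (g i (x0, ξ))) :=
      ((hgc.comp (by fun_prop : Continuous fun a : Euc n => (a, ξ))).tendsto x0).comp hxθ
    have tg2 : Tendsto (fun k => g i (y (θ k), ξ)) atTop (𝓝 (g i (x0, ξ))) :=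
      ((hgc.comp (by fun_prop : Continuous fun a : Euc n => (a, ξ))).tendsto x0).comp hyθ
    have tf1 : Tendsto (fun k => φ₁ i (x (θ k), ξ)) atTop (𝓝 (φ₁ i (x0, ξ))) :=
      (((hφ₁ i).1.comp (by fun_prop : Continuous fun a : Euc n => (a, ξ))).tendsto x0).comp hxθ
    have tf2 : Tendsto (fun k => φ₂ i (y (θ k), ξ)) atTop (𝓝 (φ₂ i (x0, ξ))) :=
      (((hφ₂ i).1.comp (by fun_prop : Continuous fun a : Euc n => (a, ξ))).tendsto x0).comp hyθ
    have t1 := ((hc1.tendsto x0).comp hxθ).add ((tg1.inner hr).neg.sub tf1)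
    have t2 := ((hc2.tendsto x0).comp hyθ).add ((tg2.inner hpθ).neg.sub tf2)
    have e1 := le_of_tendsto (b := 0) t1 (Eventually.of_forall fun k => by
      have a1 := hS1 (θ k)
      have a2 := le_ham hgc (hφ₁ i).1 (x (θ k)) (q (θ k) + p (θ k)) ξ
      simp only [Function.comp]
      linarith)
    have e2 := le_of_tendsto (b := 0) t2 (Eventually.of_forall fun k => by
      have a1 := hS2 (θ k)
      have a2 := le_ham hgc (hφ₂ i).1 (y (θ k)) (-p (θ k)) ξ
      simp only [Function.comp]
      linarith)
    rw [inner_sub_right] at e2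
    linarith
  have hsum : (∑ j, B x0 i j * (u₁ j x0 + u₂ j x0)) =
      (∑ j, B x0 i j * u₁ j x0) + (∑ j, B x0 i j * u₂ j x0) := by
    rw [← Finset.sum_add_distrib]
    exact Finset.sum_congr rfl fun j _ => by ring
  have hham : ham g (fun i q => φ₁ i q + φ₂ i q) i x0 (gradient ψ x0) ≤
      -((∑ j, B x0 i j * u₁ j x0) + (∑ j, B x0 i j * u₂ j x0)) :=
    ciSup_le fun ξ => by have := key ξ; linarith
  rw [hsum]
  linarith

lemma memF_smul {g : Fin m → Euc n × Ξ → Euc n} (hg : ∀ i, Continuous (g i))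
    {B : Euc n → Matrix (Fin m) (Fin m) ℝ}
    {φ : Fin m → Euc n × Ξ → ℝ} {u : Fin m → Euc n → ℝ}
    (h : memF B 0 g φ u) {t : ℝ} (ht : 0 < t) :
    memF B 0 g (fun i q => t * φ i q) (fun i x => t * u i x) := by
  obtain ⟨hφ, hu, hs, hts⟩ := h
  refine ⟨fun i => ⟨continuous_const.mul (hφ i).1, fun x z ξ hz => ?_⟩,
    fun i => continuous_const.mul (hu i),
    fun i => ⟨(continuous_const.mul (hu i)).upperSemicontinuous, fun x z hz => ?_⟩, ?_⟩
  · simp only [(hφ i).2 x z ξ hz]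
  · simp only [(hs i).2 x z hz]
  intro i ψ hψ hψp x0 hmax
  have h1 := hts i (fun x => t⁻¹ * ψ x) (contDiff_const.mul hψ)
    (fun x z hz => by simp only [hψp x z hz]) x0 (by
      filter_upwards [hmax] with y hy
      have := mul_le_mul_of_nonneg_left hy (inv_pos.2 ht).le
      simp only [mul_sub, inv_mul_cancel_left₀ ht.ne'] at this
      exact this)
  rw [(hasGrad_smul t⁻¹
    ((hψ.differentiable (by norm_num)).differentiableAt.hasGradientAt)).gradient] at h1
  have hham : ham g (fun i q => t * φ i q) i x0 (gradient ψ x0) ≤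
      t * ham g φ i x0 (t⁻¹ • gradient ψ x0) := by
    refine ciSup_le fun ξ => ?_
    have := mul_le_mul_of_nonneg_left (le_ham (hg i) (hφ i).1 x0 (t⁻¹ • gradient ψ x0) ξ) ht.le
    rw [inner_smul_right] at this
    refine le_trans (le_of_eq ?_) this
    field_simp
  have hsum : (∑ j, B x0 i j * (t * u j x0)) = t * ∑ j, B x0 i j * u j x0 := by
    rw [Finset.mul_sum]
    exact Finset.sum_congr rfl fun j _ => by ring
  rw [hsum]
  have := mul_nonpos_of_nonneg_of_nonpos ht.le h1
  linarith

lemma memF_mono {g : Fin m → Euc n × Ξ → Euc n} (hg : ∀ i, Continuous (g i))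
    {B : Euc n → Matrix (Fin m) (Fin m) ℝ}
    {φ φ' : Fin m → Euc n × Ξ → ℝ} {u : Fin m → Euc n → ℝ}
    (h : memF B 0 g φ u) (hc : ∀ i, Continuous (φ' i) ∧ TorusFun2 (φ' i))
    (hle : ∀ i q, φ i q ≤ φ' i q) : memF B 0 g φ' u := by
  obtain ⟨hφ, hu, hs, hts⟩ := h
  refine ⟨hc, hu, hs, fun i ψ hψ hψp x0 hmax => ?_⟩
  have h1 := hts i ψ hψ hψp x0 hmax
  have h2 : ham g φ' i x0 (gradient ψ x0) ≤ ham g φ i x0 (gradient ψ x0) :=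
    ciSup_le fun ξ => by
      have := le_ham (hg i) (hφ i).1 x0 (gradient ψ x0) ξ
      have := hle i (x0, ξ)
      linarith
  linarith

/-- comparison: a shifted problem has a subsolution only if the shift is nonnegative -/
lemma shift_nonneg {g : Fin m → Euc n × Ξ → Euc n} {L : Fin m → Euc n × Ξ → ℝ} (hm : 0 < m)
    (hgL : GoodData g L) (hcoer : Coercive g L)
    {B : Euc n → Matrix (Fin m) (Fin m) ℝ} (hB : GoodCoupling B)
    (hρ : ∀ (x : Euc n) (i : Fin m), rhoB B i x = 0)
    {v u : Fin m → Euc n → ℝ} (hv : IsSol B 0 g L (fun _ => 0) v) {a : ℝ}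
    (h : memF B 0 g (fun i q => L i q + a) u) : 0 ≤ a := by
  obtain ⟨hφ, hu, hs, hts⟩ := h
  obtain ⟨hvc, -, hvs, hvt⟩ := hv
  have : Nonempty (Fin m) := ⟨⟨0, hm⟩⟩
  obtain ⟨i, xh, x, y, κ, hx, hy, hmx, hd⟩ := doubling
    (fun (i : Fin m) (q : Euc n × Euc n) => u i q.1 - v i q.2)
    (fun i => ((hu i).comp continuous_fst).sub ((hvc i).comp continuous_snd))
    (fun i x y z w hz hw => by simp only [(hs i).2 x z hz, (hvs i).2 y w hw])
  set p : ℕ → Euc n := fun k => κ k • gradient Pen (x k - y k) with hp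
  have hS1 : ∀ k, (∑ j, B (x k) i j * u j (x k)) +
      ham g (fun i q => L i q + a) i (x k) (p k) ≤ 0 := by
    intro k
    have hcd : ContDiff ℝ 1 (fun a => κ k * Pen (a - y k)) := by
      have := Pen_contDiff (n := n)
      fun_prop
    have htp : TorusFun (fun a => κ k * Pen (a - y k)) := by
      intro a z hz
      simp only [show a + z - y k = (a - y k) + z by abel, Pen_per _ _ hz]
    have := hts i _ hcd htp (x k) (Eventually.of_forall fun a => by
      have := hmx k i a (y k)
      simp only at this
      linarith)
    rw [(hasGrad_left (κ k) (x k) (y k)).gradient] at this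
    linarith
  have hS2 : ∀ k, 0 ≤ (∑ j, B (y k) i j * v j (y k)) + ham g L i (y k) (p k) := by
    intro k
    have hcd : ContDiff ℝ 1 (fun b => (-κ k) * Pen (x k - b)) := by
      have := Pen_contDiff (n := n)
      fun_prop
    have htp : TorusFun (fun b => (-κ k) * Pen (x k - b)) := by
      intro a z hz
      simp only [show x k - (a + z) = (x k - a) - z by abel, Pen_per.sub_int _ hz]
    have := hvt i _ hcd htp (y k) (Eventually.of_forall fun b => by
      have := hmx k i (x k) b
      simp only at this
      linarith)
    rw [(hasGrad_right (-κ k) (x k) (y k)).gradient, neg_smul, neg_neg] at this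
    linarith
  have hc1 : Continuous fun x => ∑ j, B x i j * u j x :=
    continuous_finsetSum _ fun j _ => (hB.1 i j).1.mul (hu j)
  have hc2 : Continuous fun x => ∑ j, B x i j * v j x :=
    continuous_finsetSum _ fun j _ => (hB.1 i j).1.mul (hvc j)
  obtain ⟨M, hM⟩ := bounded_along hc1 hx
  obtain ⟨R, hR⟩ := coercive_bound hgL (φ := fun i q => L i q + a) hcoer i (hφ i) M
  have hgc := (hgL.1 i).1
  have hLc := (hgL.2 i).1
  have hξ : ∀ k, ∃ ξ, ham g L i (y k) (p k) = -⟪g i (y k, ξ), p k⟫ - L i (y k, ξ) :=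
    fun k => ham_attained hgc hLc _ _
  choose ξ hξ using hξ
  have hb : ∀ k, (p k, ξ k) ∈ Metric.closedBall (0 : Euc n) R ×ˢ (Set.univ : Set Ξ) := by
    intro k
    refine ⟨?_, Set.mem_univ _⟩
    rw [mem_closedBall_zero_iff]
    refine hR (x k) _ ?_
    have := hM k
    have := hS1 k
    linarith
  obtain ⟨⟨r, η⟩, -, θ, hθ, hr⟩ :=
    ((isCompact_closedBall (0 : Euc n) R).prod isCompact_univ).tendsto_subseq hb
  have hxθ := hx.comp hθ.tendsto_atTop
  have hyθ := hy.comp hθ.tendsto_atTop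
  have hpθ : Tendsto (fun k => p (θ k)) atTop (𝓝 r) := (continuous_fst.tendsto _).comp hr
  have hξθ : Tendsto (fun k => ξ (θ k)) atTop (𝓝 η) := (continuous_snd.tendsto _).comp hr
  have tg1 := (hgc.tendsto (xh, η)).comp (hxθ.prodMk_nhds hξθ)
  have tg2 := (hgc.tendsto (xh, η)).comp (hyθ.prodMk_nhds hξθ)
  have tl1 := (hLc.tendsto (xh, η)).comp (hxθ.prodMk_nhds hξθ)
  have tl2 := (hLc.tendsto (xh, η)).comp (hyθ.prodMk_nhds hξθ)
  have e1 := le_of_tendsto (b := 0) (((hc1.tendsto xh).comp hxθ).add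
    ((tg1.inner hpθ).neg.sub (tl1.add_const a))) (Eventually.of_forall fun k => by
      have a1 := hS1 (θ k)
      have a2 := le_ham (φ := fun i q => L i q + a) hgc (hφ i).1 (x (θ k)) (p (θ k)) (ξ (θ k))
      simp only [Function.comp]
      linarith)
  have e2 := ge_of_tendsto (b := 0) (((hc2.tendsto xh).comp hyθ).add
    ((tg2.inner hpθ).neg.sub tl2)) (Eventually.of_forall fun k => by
      have a1 := hS2 (θ k)
      rw [hξ] at a1
      simp only [Function.comp]
      linarith)
  have hmono := hB.2 xh (fun j => (u j xh - v j xh) - (u i xh - v i xh)) i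
    (fun j => by have := hd j xh; simp only at this ⊢; linarith) (by simp)
  have hsum : (∑ j, B xh i j * ((u j xh - v j xh) - (u i xh - v i xh))) =
      (∑ j, B xh i j * u j xh) - (∑ j, B xh i j * v j xh) -
        (∑ j, B xh i j) * (u i xh - v i xh) := by
    rw [Finset.sum_mul, ← Finset.sum_sub_distrib, ← Finset.sum_sub_distrib]
    exact Finset.sum_congr rfl fun j _ => by ring
  have h0 : ∑ j, B xh i j = 0 := hρ xh i
  rw [hsum, h0] at hmono
  linarith

end

lemma riesz_cpt {X : Type*} [TopologicalSpace X] [CompactSpace X] [T2Space X]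
    [MeasurableSpace X] [BorelSpace X] (Λ : C(X, ℝ) →ₗ[ℝ] ℝ)
    (hΛ : ∀ f : C(X, ℝ), (∀ x, 0 ≤ f x) → 0 ≤ Λ f) :
    ∃ μ : Measure X, IsFiniteMeasure μ ∧ ∀ f : C(X, ℝ), ∫ x, f x ∂μ = Λ f := by
  let T : CompactlySupportedContinuousMap X ℝ →ₗ[ℝ] ℝ :=
    { toFun := fun f => Λ f.toContinuousMap
      map_add' := fun f h => by rw [← map_add]; rfl
      map_smul' := fun c f => by rw [RingHom.id_apply, ← map_smul]; rfl }
  let T' : CompactlySupportedContinuousMap X ℝ →ₚ[ℝ] ℝ :=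
    PositiveLinearMap.mk₀ T (fun f hf => hΛ _ (fun x => hf x))
  refine ⟨RealRMK.rieszMeasure T', ⟨isCompact_univ.measure_lt_top⟩, fun f => ?_⟩
  exact RealRMK.integral_rieszMeasure T'
    (CompactlySupportedContinuousMap.continuousMapEquiv f)

section
variable {n m : ℕ} {Ξ : Type*} [MetricSpace Ξ] [CompactSpace Ξ] [Nonempty Ξ]

/-- continuous functions on the fundamental cell -/
abbrev CellFun (n m : ℕ) (Ξ : Type*) [MetricSpace Ξ] : Type _ :=
  Fin m → C(↥(cube n) × Ξ, ℝ)

def res (φ : Fin m → Euc n × Ξ → ℝ) (hφ : ∀ i, Continuous (φ i)) : CellFun n m Ξ :=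
  fun i => ⟨fun q => φ i (q.1.1, q.2), (hφ i).comp (by fun_prop)⟩

/-- extension of cell inequalities to the whole space -/
lemma le_of_cell {φ ψ : Euc n × Ξ → ℝ} (hφ : TorusFun2 φ) (hψ : TorusFun2 ψ)
    (h : ∀ q : ↥(cube n) × Ξ, φ (q.1.1, q.2) ≤ ψ (q.1.1, q.2)) (q : Euc n × Ξ) : φ q ≤ ψ q := by
  obtain ⟨x, ξ⟩ := q
  obtain ⟨z, hz, hzx⟩ := exists_cube x
  rw [← hφ x z ξ hz, ← hψ x z ξ hz]
  exact h (⟨x + z, hzx⟩, ξ)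

def InCone (B : Euc n → Matrix (Fin m) (Fin m) ℝ) (g : Fin m → Euc n × Ξ → Euc n)
    (L : Fin m → Euc n × Ξ → ℝ) (f : CellFun n m Ξ) : Prop :=
  ∃ (t : ℝ) (ψ : Fin m → Euc n × Ξ → ℝ) (u : Fin m → Euc n → ℝ), 0 < t ∧ memF B 0 g ψ u ∧
    ∀ i q, ψ i (q.1.1, q.2) ≤ f i q + t * L i (q.1.1, q.2)

theorem exists_functional (hm : 0 < m)
    (g : Fin m → Euc n × Ξ → Euc n) (L : Fin m → Euc n × Ξ → ℝ)
    (hgL : GoodData g L) (hcoer : Coercive g L)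
    (B : Euc n → Matrix (Fin m) (Fin m) ℝ) (hB : GoodCoupling B)
    (hρ : ∀ (x : Euc n) (i : Fin m), rhoB B i x = 0)
    {v : Fin m → Euc n → ℝ} (hv : IsSol B 0 g L (fun _ => 0) v) :
    ∃ Λ : CellFun n m Ξ →ₗ[ℝ] ℝ, Λ (fun _ => 1) = 1 ∧ ∀ f, InCone B g L f → 0 ≤ Λ f := by
  have hgc := fun i => (hgL.1 i).1
  have hLF : memF B 0 g L v := ⟨hgL.2, hv.1, hv.2.1⟩
  have hpos : ∀ f : CellFun n m Ξ, (∀ i q, 0 ≤ f i q) → InCone B g L f := fun f hf =>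
    ⟨1, L, v, one_pos, hLF, fun i q => by linarith [hf i q]⟩
  have hadd : ∀ f h : CellFun n m Ξ, InCone B g L f → InCone B g L h → InCone B g L (f + h) := by
    rintro f h ⟨t, ψ, u, ht, hF, hle⟩ ⟨t', ψ', u', ht', hF', hle'⟩
    refine ⟨t + t', _, _, add_pos ht ht', memF_add hgL hcoer hB hF hF', fun i q => ?_⟩
    have h1 := hle i q
    have h2 := hle' i q
    simp only [Pi.add_apply, ContinuousMap.add_apply]
    linarith
  have hsmul : ∀ (c : ℝ) (f : CellFun n m Ξ), 0 < c → InCone B g L f → InCone B g L (c • f) := by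
    rintro c f hc ⟨t, ψ, u, ht, hF, hle⟩
    refine ⟨c * t, _, _, mul_pos hc ht, memF_smul hgc hF hc, fun i q => ?_⟩
    have h1 := mul_le_mul_of_nonneg_left (hle i q) hc.le
    simp only [Pi.smul_apply, ContinuousMap.smul_apply, smul_eq_mul]
    linarith
  have hzero : InCone B g L (0 : CellFun n m Ξ) := hpos 0 fun i q => by simp
  let s : PointedCone ℝ (CellFun n m Ξ) :=
    { carrier := {f | InCone B g L f}
      add_mem' := fun {a b} ha hb => hadd a b ha hb
      zero_mem' := hzero
      smul_mem' := fun c f hf => by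
        rcases eq_or_lt_of_le c.2 with h | h
        · have : c = 0 := Subtype.ext h.symm
          rw [this, zero_smul]
          exact hzero
        · exact hsmul c.1 f h hf }
  obtain ⟨z0, hz0, hz0c⟩ := exists_cube (0 : Euc n)
  have hone : (fun _ => 1 : CellFun n m Ξ) ≠ 0 := by
    intro h
    have h1 := congrFun h ⟨0, hm⟩
    have h2 := DFunLike.congr_fun h1 (⟨0 + z0, hz0c⟩, Classical.arbitrary Ξ)
    simp at h2
  let f : CellFun n m Ξ →ₗ.[ℝ] ℝ :=
    LinearPMap.mkSpanSingleton (fun _ => 1 : CellFun n m Ξ) (1 : ℝ) hone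
  have hnon : ∀ x : f.domain, (x : CellFun n m Ξ) ∈ s → 0 ≤ f x := by
    rintro ⟨x, hx⟩ hxs
    obtain ⟨a, rfl⟩ := Submodule.mem_span_singleton.1 hx
    have : f ⟨a • (fun _ => 1 : CellFun n m Ξ), hx⟩ = a • (1 : ℝ) :=
      LinearPMap.mkSpanSingleton'_apply ..
    rw [this, smul_eq_mul, mul_one]
    obtain ⟨t, ψ, u, ht, hF, hle⟩ := (show InCone B g L (a • (fun _ => 1 : CellFun n m Ξ)) from hxs)
    have h1 := memF_smul hgc hF (inv_pos.2 ht)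
    have h2 : memF B 0 g (fun i q => L i q + t⁻¹ * a) (fun i x => t⁻¹ * u i x) := by
      have hper : ∀ i, TorusFun2 (fun q => L i q + t⁻¹ * a) := fun i x z ξ hz => by
        simp only [(hgL.2 i).2 x z ξ hz]
      refine memF_mono hgc h1 (fun i => ⟨(hgL.2 i).1.add continuous_const, hper i⟩) fun i q =>
        le_of_cell (h1.1 i).2 (hper i) (fun q => ?_) q
      have := mul_le_mul_of_nonneg_left (hle i q) (inv_pos.2 ht).le
      simp only [Pi.smul_apply, ContinuousMap.smul_apply, ContinuousMap.one_apply, smul_eq_mul,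
        mul_one, mul_add, inv_mul_cancel_left₀ ht.ne'] at this
      linarith
    have h3 := shift_nonneg hm hgL hcoer hB hρ hv h2
    exact nonneg_of_mul_nonneg_right h3 (inv_pos.2 ht)
  have hCC : CompactSpace ↥(cube n) := isCompact_iff_compactSpace.1 (isCompact_cube n)
  have hdense : ∀ y, ∃ x : f.domain, (x : CellFun n m Ξ) + y ∈ s := by
    intro y
    refine ⟨⟨(∑ j, ‖y j‖) • (fun _ => 1 : CellFun n m Ξ),
      Submodule.mem_span_singleton.2 ⟨_, rfl⟩⟩, hpos _ fun i q => ?_⟩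
    have h1 := (y i).norm_coe_le_norm q
    have h2 : ‖y i‖ ≤ ∑ j, ‖y j‖ :=
      Finset.single_le_sum (f := fun j => ‖y j‖) (fun j _ => norm_nonneg _) (Finset.mem_univ i)
    have h3 := neg_abs_le (y i q)
    rw [Real.norm_eq_abs] at h1
    simp only [Pi.add_apply, Pi.smul_apply, ContinuousMap.add_apply, ContinuousMap.smul_apply,
      ContinuousMap.one_apply, smul_eq_mul, mul_one]
    linarith
  obtain ⟨Λ, hΛ1, hΛ2⟩ := riesz_extension s f hnon hdense
  refine ⟨Λ, ?_, hΛ2⟩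
  have := hΛ1 ⟨(1 : ℝ) • (fun _ => 1 : CellFun n m Ξ), Submodule.mem_span_singleton.2 ⟨_, rfl⟩⟩
  have h2 : f ⟨(1 : ℝ) • (fun _ => 1 : CellFun n m Ξ), Submodule.mem_span_singleton.2 ⟨_, rfl⟩⟩
      = (1 : ℝ) • (1 : ℝ) := LinearPMap.mkSpanSingleton'_apply ..
  rw [h2] at this
  simpa using this

end

theorem stmt10 {n m : ℕ} (hn : 0 < n) (hm : 0 < m)
    {Ξ : Type*} [MetricSpace Ξ] [CompactSpace Ξ] [Nonempty Ξ]
    [MeasurableSpace Ξ] [BorelSpace Ξ]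
    (g : Fin m → Euc n × Ξ → Euc n) (L : Fin m → Euc n × Ξ → ℝ)
    (hgL : GoodData g L) (hcoer : Coercive g L)
    (B : Euc n → Matrix (Fin m) (Fin m) ℝ) (hB : GoodCoupling B)
    (hE : AssumptionE B g L)
    (hρ : ∀ (x : Euc n) (i : Fin m), rhoB B i x = 0) :
    ∃ μ0 : Fin m → Measure (Euc n × Ξ), memP0 B g μ0 ∧
      (∑ i, ∫ q, L i q ∂(μ0 i)) = 0 ∧
      ∀ μ : Fin m → Measure (Euc n × Ξ), memP0 B g μ →
        0 ≤ ∑ i, ∫ q, L i q ∂(μ i) := by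
  obtain ⟨v, -, hv⟩ := hE
  have hLF : memF B 0 g L v := ⟨hgL.2, hv.1, hv.2.1⟩
  obtain ⟨Λ, hΛ1, hΛ⟩ := exists_functional hm g L hgL hcoer B hB hρ hv
  have hCC : CompactSpace ↥(cube n) := isCompact_iff_compactSpace.1 (isCompact_cube n)
  have hR : ∀ i : Fin m, ∃ μ : Measure (↥(cube n) × Ξ), IsFiniteMeasure μ ∧
      ∀ f : C(↥(cube n) × Ξ, ℝ), ∫ x, f x ∂μ = Λ (Pi.single i f) := by
    intro i
    refine riesz_cpt (Λ ∘ₗ LinearMap.single ℝ (fun _ : Fin m => C(↥(cube n) × Ξ, ℝ)) i) ?_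
    intro f hf
    refine hΛ _ ⟨1, L, v, one_pos, hLF, fun j q => ?_⟩
    have : 0 ≤ (Pi.single i f : CellFun n m Ξ) j q := by
      rcases eq_or_ne j i with rfl | h
      · simpa using hf q
      · simp [Pi.single_eq_of_ne h]
    simp only [LinearMap.single_apply]
    linarith
  choose μ hfin hμ using hR
  have hemb : Measurable (fun q : ↥(cube n) × Ξ => ((q.1 : Euc n), q.2)) := by fun_prop
  have hIntegral : ∀ φ : Fin m → Euc n × Ξ → ℝ, ∀ hφ : ∀ i, Continuous (φ i),
      ∑ i, ∫ q, φ i q ∂((μ i).map (fun q : ↥(cube n) × Ξ => ((q.1 : Euc n), q.2))) =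
        Λ (res φ hφ) := by
    intro φ hφ
    have h1 : res φ hφ = ∑ i, Pi.single i (res φ hφ i) := (Finset.univ_sum_single _).symm
    rw [h1, map_sum]
    refine Finset.sum_congr rfl fun i _ => ?_
    rw [integral_map hemb.aemeasurable (hφ i).aestronglyMeasurable, ← hμ i]
    rfl
  have hF : ∀ φ u, memF B 0 g φ u → 0 ≤
      ∑ i, ∫ q, φ i q ∂((μ i).map (fun q : ↥(cube n) × Ξ => ((q.1 : Euc n), q.2))) := by
    intro φ u h
    rw [hIntegral φ fun i => (h.1 i).1]
    refine hΛ _ ⟨1, _, _, one_pos, memF_add hgL hcoer hB h hLF, fun i q => ?_⟩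
    simp [res]
  refine ⟨fun i => (μ i).map (fun q : ↥(cube n) × Ξ => ((q.1 : Euc n), q.2)),
    ⟨⟨fun i => Measure.isFiniteMeasure_map _ _, ?_⟩, hF⟩, ?_, fun μ' hμ' => hμ'.2 L v hLF⟩
  · have h1 := hIntegral (fun _ _ => 1) (fun _ => continuous_const)
    have h2 : res (fun _ _ => 1) (fun _ => continuous_const) = (fun _ => 1 : CellFun n m Ξ) := rfl
    rw [h2, hΛ1] at h1
    rw [← h1]
    refine Finset.sum_congr rfl fun i _ => ?_
    simp [Measure.real]
  · refine le_antisymm ?_ (hF L v hLF)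
    rw [hIntegral L fun i => (hgL.2 i).1]
    have h1 := hΛ (-(res L fun i => (hgL.2 i).1)) (by
      have h0 := memF_smul (fun i => (hgL.1 i).1) hLF one_pos
      refine ⟨2, _, _, two_pos, h0, fun i q => ?_⟩
      simp [res]
      linarith)
    rw [map_neg] at h1
    linarith
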